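/- Let Ω ⊆ ℝⁿ be open, q : Ω → ℂ continuous, and let u₁, u₂ ∈ C²(Ω;ℂ) satisfy Δu_j + q u_j = 0 in Ω for j = 1, 2. Let μ ∈ C²(Ω;ℂ) and set H_j := μ u_j. Then the transport identity (H₁∇H₂ − H₂∇H₁)·∇μ + (1/2)(H₂ΔH₁ − H₁ΔH₂) μ = 0 holds at every point of Ω. -/

import Mathlib

open scoped BigOperators

/-- Partial derivative (in direction `i`) of a complex-valued function on `ℝⁿ`. -/
noncomputable def pdC {n : ℕ} (f : (Fin n → ℝ) → ℂ) (i : Fin n) (x : Fin n → ℝ) : ℂ :=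
  fderiv ℝ f x (Pi.single i 1)

/-- Euclidean Laplacian of a complex-valued function on `ℝⁿ`. -/
noncomputable def lapC {n : ℕ} (f : (Fin n → ℝ) → ℂ) (x : Fin n → ℝ) : ℂ :=
  ∑ i, pdC (pdC f i) i x

theorem pdC_mul_aux {n : ℕ} (f g : (Fin n → ℝ) → ℂ) (i : Fin n) (x : Fin n → ℝ)
    (hf : DifferentiableAt ℝ f x) (hg : DifferentiableAt ℝ g x) :
    pdC (fun y => f y * g y) i x = pdC f i x * g x + f x * pdC g i x := by
  unfold pdC
  rw [fderiv_fun_mul hf hg]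
  simp
  ring

theorem pdC_diff_aux {n : ℕ} (Ω : Set (Fin n → ℝ)) (hΩ : IsOpen Ω) (f : (Fin n → ℝ) → ℂ)
    (hf : ContDiffOn ℝ 2 f Ω) (i : Fin n) (x : Fin n → ℝ) (hx : x ∈ Ω) :
    DifferentiableAt ℝ (pdC f i) x := by
  have h1 : ContDiffAt ℝ 2 f x := hf.contDiffAt (hΩ.mem_nhds hx)
  have h2 : ContDiffAt ℝ 1 (fderiv ℝ f) x := h1.fderiv_right (by norm_num)
  have h3 : DifferentiableAt ℝ (fderiv ℝ f) x := h2.differentiableAt (by norm_num)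
  exact h3.clm_apply (differentiableAt_const _)

theorem lapC_mul_aux {n : ℕ} (Ω : Set (Fin n → ℝ)) (hΩ : IsOpen Ω) (f g : (Fin n → ℝ) → ℂ)
    (hf : ContDiffOn ℝ 2 f Ω) (hg : ContDiffOn ℝ 2 g Ω) (x : Fin n → ℝ) (hx : x ∈ Ω) :
    lapC (fun y => f y * g y) x
      = lapC f x * g x + 2 * (∑ i, pdC f i x * pdC g i x) + f x * lapC g x := by
  have hd : ∀ h : (Fin n → ℝ) → ℂ, ContDiffOn ℝ 2 h Ω → ∀ y ∈ Ω, DifferentiableAt ℝ h y :=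
    fun h hh y hy => (hh.contDiffAt (hΩ.mem_nhds hy)).differentiableAt (by norm_num)
  unfold lapC
  rw [Finset.sum_mul, Finset.mul_sum, Finset.mul_sum, ← Finset.sum_add_distrib,
    ← Finset.sum_add_distrib]
  refine Finset.sum_congr rfl fun i _ => ?_
  have he : pdC (fun y => f y * g y) i =ᶠ[nhds x]
      fun y => pdC f i y * g y + f y * pdC g i y := by
    filter_upwards [hΩ.mem_nhds hx] with y hy
    exact pdC_mul_aux f g i y (hd f hf y hy) (hd g hg y hy)
  have hf' := pdC_diff_aux Ω hΩ f hf i x hx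
  have hg' := pdC_diff_aux Ω hΩ g hg i x hx
  have e1 : pdC (pdC (fun y => f y * g y) i) i x
      = pdC (fun y => pdC f i y * g y) i x + pdC (fun y => f y * pdC g i y) i x := by
    rw [pdC, he.fderiv_eq, fderiv_fun_add (hf'.fun_mul (hd g hg x hx)) ((hd f hf x hx).fun_mul hg')]
    rfl
  rw [e1, pdC_mul_aux _ _ i x hf' (hd g hg x hx), pdC_mul_aux _ _ i x (hd f hf x hx) hg']
  ring

/-- If `u₁, u₂` solve `Δu + qu = 0` in `Ω` and `H_j := μ u_j`, then the transport identity
`(H₁∇H₂ − H₂∇H₁)·∇μ + (1/2)(H₂ΔH₁ − H₁ΔH₂)μ = 0` holds in `Ω`. -/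
theorem qpat_transport_identity {n : ℕ} (Ω : Set (Fin n → ℝ)) (hΩ : IsOpen Ω)
    (q u₁ u₂ μ : (Fin n → ℝ) → ℂ)
    (hq : ContinuousOn q Ω)
    (hu₁ : ContDiffOn ℝ 2 u₁ Ω) (hu₂ : ContDiffOn ℝ 2 u₂ Ω)
    (hμ : ContDiffOn ℝ 2 μ Ω)
    (heq₁ : ∀ x ∈ Ω, lapC u₁ x + q x * u₁ x = 0)
    (heq₂ : ∀ x ∈ Ω, lapC u₂ x + q x * u₂ x = 0)
    (H₁ H₂ : (Fin n → ℝ) → ℂ)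
    (hH₁ : ∀ x, H₁ x = μ x * u₁ x) (hH₂ : ∀ x, H₂ x = μ x * u₂ x) :
    ∀ x ∈ Ω,
      (∑ i, (H₁ x * pdC H₂ i x - H₂ x * pdC H₁ i x) * pdC μ i x)
        + (1 / 2) * (H₂ x * lapC H₁ x - H₁ x * lapC H₂ x) * μ x = 0 := by
  intro x hx
  have hd : ∀ h : (Fin n → ℝ) → ℂ, ContDiffOn ℝ 2 h Ω → DifferentiableAt ℝ h x :=
    fun h hh => (hh.contDiffAt (hΩ.mem_nhds hx)).differentiableAt (by norm_num)
  obtain rfl : H₁ = fun y => μ y * u₁ y := funext hH₁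
  obtain rfl : H₂ = fun y => μ y * u₂ y := funext hH₂
  rw [lapC_mul_aux Ω hΩ μ u₁ hμ hu₁ x hx, lapC_mul_aux Ω hΩ μ u₂ hμ hu₂ x hx]
  have hs : (∑ i, ((μ x * u₁ x) * pdC (fun y => μ y * u₂ y) i x
        - (μ x * u₂ x) * pdC (fun y => μ y * u₁ y) i x) * pdC μ i x)
      = μ x ^ 2 * u₁ x * (∑ i, pdC μ i x * pdC u₂ i x)
        - μ x ^ 2 * u₂ x * (∑ i, pdC μ i x * pdC u₁ i x) := by
    rw [Finset.mul_sum, Finset.mul_sum, ← Finset.sum_sub_distrib]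
    refine Finset.sum_congr rfl fun i _ => ?_
    rw [pdC_mul_aux μ u₁ i x (hd μ hμ) (hd u₁ hu₁), pdC_mul_aux μ u₂ i x (hd μ hμ) (hd u₂ hu₂)]
    ring
  rw [hs]
  have h1 := heq₁ x hx
  have h2 := heq₂ x hx
  linear_combination (1 / 2) * μ x ^ 3 * u₂ x * h1 - (1 / 2) * μ x ^ 3 * u₁ x * h2
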